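/- Let 2/3 < γ < 2 and let x be a Bianchi type IX solution of the Wainwright–Hsu system having a non-special α-limit point p on the Kasner circle. Then p lies in exactly one of the arcs K₁, K₂, K₃, say p ∈ Kᵢ, and for any vacuum type II solution y with Nᵢ > 0 (and the other two N's identically zero) whose ω-limit point is p, the closure of the image of y is contained in the α-limit set of x. -/

import Mathlib

open Real Filter Topology Set

noncomputable section

namespace WainwrightHsu

/-- The deceleration parameter `q` of the Wainwright–Hsu system. -/
def qf (γ O Sp Sm : ℝ) : ℝ := (1/2) * (3*γ - 2) * O + 2 * (Sp^2 + Sm^2)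

/-- The curvature term `S₊`. -/
def SPf (n1 n2 n3 : ℝ) : ℝ := (1/2) * ((n2 - n3)^2 - n1 * (2*n1 - n2 - n3))

/-- The curvature term `S₋`. -/
def SMf (n1 n2 n3 : ℝ) : ℝ := (Real.sqrt 3 / 2) * (n3 - n2) * (n1 - n2 - n3)

/-- The Hamiltonian constraint. -/
def Constraint (O Sp Sm n1 n2 n3 : ℝ) : Prop :=
  O + Sp^2 + Sm^2 + (3/4) * (n1^2 + n2^2 + n3^2 - 2*(n1*n2 + n2*n3 + n3*n1)) = 1

/-- `(O, Sp, Sm, n1, n2, n3)` is a solution of the Wainwright–Hsu system (with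
parameter `γ`) on the set `s ⊆ ℝ`, satisfying `Ω ≥ 0` and the constraint. -/
structure SolOn (γ : ℝ) (s : Set ℝ) (O Sp Sm n1 n2 n3 : ℝ → ℝ) : Prop where
  hn1 : ∀ τ ∈ s, HasDerivAt n1 ((qf γ (O τ) (Sp τ) (Sm τ) - 4 * Sp τ) * n1 τ) τ
  hn2 : ∀ τ ∈ s, HasDerivAt n2
    ((qf γ (O τ) (Sp τ) (Sm τ) + 2 * Sp τ + 2 * Real.sqrt 3 * Sm τ) * n2 τ) τ
  hn3 : ∀ τ ∈ s, HasDerivAt n3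
    ((qf γ (O τ) (Sp τ) (Sm τ) + 2 * Sp τ - 2 * Real.sqrt 3 * Sm τ) * n3 τ) τ
  hSp : ∀ τ ∈ s, HasDerivAt Sp
    (-(2 - qf γ (O τ) (Sp τ) (Sm τ)) * Sp τ - 3 * SPf (n1 τ) (n2 τ) (n3 τ)) τ
  hSm : ∀ τ ∈ s, HasDerivAt Sm
    (-(2 - qf γ (O τ) (Sp τ) (Sm τ)) * Sm τ - 3 * SMf (n1 τ) (n2 τ) (n3 τ)) τ
  hO : ∀ τ ∈ s, HasDerivAt O ((2 * qf γ (O τ) (Sp τ) (Sm τ) - (3*γ - 2)) * O τ) τ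
  hOnn : ∀ τ ∈ s, 0 ≤ O τ
  hcon : ∀ τ ∈ s, Constraint (O τ) (Sp τ) (Sm τ) (n1 τ) (n2 τ) (n3 τ)

/-- The solution is of Taub type. -/
def TaubType (s : Set ℝ) (Sp Sm n1 n2 n3 : ℝ → ℝ) : Prop :=
  (∀ τ ∈ s, Sm τ = 0 ∧ n2 τ = n3 τ) ∨
  (∀ τ ∈ s, Sm τ = -(Real.sqrt 3) * Sp τ ∧ n1 τ = n2 τ) ∨
  (∀ τ ∈ s, Sm τ = Real.sqrt 3 * Sp τ ∧ n3 τ = n1 τ)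

/-- The solution converges to the fixed point `F` as `τ → -∞`. -/
def TendstoF (O Sp Sm n1 n2 n3 : ℝ → ℝ) : Prop :=
  Tendsto O atBot (𝓝 1) ∧ Tendsto Sp atBot (𝓝 0) ∧ Tendsto Sm atBot (𝓝 0) ∧
  Tendsto n1 atBot (𝓝 0) ∧ Tendsto n2 atBot (𝓝 0) ∧ Tendsto n3 atBot (𝓝 0)

/-- The solution converges to the fixed point `P₁⁺(II)` as `τ → -∞`. -/
def TendstoP1 (γ : ℝ) (O Sp Sm n1 n2 n3 : ℝ → ℝ) : Prop :=
  Tendsto O atBot (𝓝 (1 - (3*γ - 2)/16)) ∧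
  Tendsto Sp atBot (𝓝 ((3*γ - 2)/8)) ∧ Tendsto Sm atBot (𝓝 0) ∧
  (∃ c : ℝ, 0 < c ∧ Tendsto n1 atBot (𝓝 c)) ∧
  Tendsto n2 atBot (𝓝 0) ∧ Tendsto n3 atBot (𝓝 0)

/-- The solution converges to the fixed point `P₂⁺(II)` as `τ → -∞`. -/
def TendstoP2 (γ : ℝ) (O Sp Sm n1 n2 n3 : ℝ → ℝ) : Prop :=
  Tendsto O atBot (𝓝 (1 - (3*γ - 2)/16)) ∧
  Tendsto Sp atBot (𝓝 (-((3*γ - 2)/16))) ∧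
  Tendsto Sm atBot (𝓝 (-(Real.sqrt 3 * (3*γ - 2)/16))) ∧
  Tendsto n1 atBot (𝓝 0) ∧
  (∃ c : ℝ, 0 < c ∧ Tendsto n2 atBot (𝓝 c)) ∧ Tendsto n3 atBot (𝓝 0)

/-- The solution converges to the fixed point `P₃⁺(II)` as `τ → -∞`. -/
def TendstoP3 (γ : ℝ) (O Sp Sm n1 n2 n3 : ℝ → ℝ) : Prop :=
  Tendsto O atBot (𝓝 (1 - (3*γ - 2)/16)) ∧
  Tendsto Sp atBot (𝓝 (-((3*γ - 2)/16))) ∧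
  Tendsto Sm atBot (𝓝 (Real.sqrt 3 * (3*γ - 2)/16)) ∧
  Tendsto n1 atBot (𝓝 0) ∧ Tendsto n2 atBot (𝓝 0) ∧
  (∃ c : ℝ, 0 < c ∧ Tendsto n3 atBot (𝓝 c))

/-- A Bianchi IX solution is generic if it is not of Taub type and does not
converge to `F` nor to any of the `Pᵢ⁺(II)` as `τ → -∞`. -/
def Generic (γ : ℝ) (s : Set ℝ) (O Sp Sm n1 n2 n3 : ℝ → ℝ) : Prop :=
  ¬ TaubType s Sp Sm n1 n2 n3 ∧ ¬ TendstoF O Sp Sm n1 n2 n3 ∧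
  ¬ TendstoP1 γ O Sp Sm n1 n2 n3 ∧ ¬ TendstoP2 γ O Sp Sm n1 n2 n3 ∧
  ¬ TendstoP3 γ O Sp Sm n1 n2 n3

/-- `(a, b, c, d, e, f)` is an α-limit point of the solution:
some sequence of times tending to `-∞` along which the solution converges to it. -/
def AlphaLim (O Sp Sm n1 n2 n3 : ℝ → ℝ) (a b c d e f : ℝ) : Prop :=
  ∃ τs : ℕ → ℝ, Tendsto τs atTop atBot ∧
    Tendsto (fun k => O (τs k)) atTop (𝓝 a) ∧
    Tendsto (fun k => Sp (τs k)) atTop (𝓝 b) ∧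
    Tendsto (fun k => Sm (τs k)) atTop (𝓝 c) ∧
    Tendsto (fun k => n1 (τs k)) atTop (𝓝 d) ∧
    Tendsto (fun k => n2 (τs k)) atTop (𝓝 e) ∧
    Tendsto (fun k => n3 (τs k)) atTop (𝓝 f)

/-- ω-limit point (times tending to `+∞`). -/
def OmegaLim (O Sp Sm n1 n2 n3 : ℝ → ℝ) (a b c d e f : ℝ) : Prop :=
  ∃ τs : ℕ → ℝ, Tendsto τs atTop atTop ∧
    Tendsto (fun k => O (τs k)) atTop (𝓝 a) ∧
    Tendsto (fun k => Sp (τs k)) atTop (𝓝 b) ∧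
    Tendsto (fun k => Sm (τs k)) atTop (𝓝 c) ∧
    Tendsto (fun k => n1 (τs k)) atTop (𝓝 d) ∧
    Tendsto (fun k => n2 (τs k)) atTop (𝓝 e) ∧
    Tendsto (fun k => n3 (τs k)) atTop (𝓝 f)

/-- α-limit point, phrased for a point of `ℝ⁶` (in coordinates `Ω, Σ₊, Σ₋, N₁, N₂, N₃`). -/
def AlphaLimPt (O Sp Sm n1 n2 n3 : ℝ → ℝ) (p : Fin 6 → ℝ) : Prop :=
  ∃ τs : ℕ → ℝ, Tendsto τs atTop atBot ∧
    Tendsto (fun k =>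
      (![O (τs k), Sp (τs k), Sm (τs k), n1 (τs k), n2 (τs k), n3 (τs k)] : Fin 6 → ℝ))
      atTop (𝓝 p)

/-- A non-special point of the Kasner circle, given by its `(Σ₊, Σ₋)` coordinates. -/
def NonSpecialKasner (a b : ℝ) : Prop :=
  a^2 + b^2 = 1 ∧ (a, b) ≠ (-1, 0) ∧
  (a, b) ≠ (1/2, Real.sqrt 3 / 2) ∧ (a, b) ≠ (1/2, -(Real.sqrt 3) / 2)

/-- The state vector of a solution, as a point of Euclidean `ℝ⁶`. -/
def stateVec (O Sp Sm n1 n2 n3 : ℝ → ℝ) (τ : ℝ) : EuclideanSpace ℝ (Fin 6) :=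
  (WithLp.equiv 2 (Fin 6 → ℝ)).symm ![O τ, Sp τ, Sm τ, n1 τ, n2 τ, n3 τ]

/-- The Bianchi attractor `𝒜`: the closure of the vacuum type I and II points, i.e. the
points of `ℝ⁶` satisfying the constraint with `Ω = 0` and `N₁N₂ = N₂N₃ = N₃N₁ = 0`. -/
def attractor : Set (EuclideanSpace ℝ (Fin 6)) :=
  {y | Constraint (y 0) (y 1) (y 2) (y 3) (y 4) (y 5) ∧
    y 0 = 0 ∧ y 3 * y 4 = 0 ∧ y 4 * y 5 = 0 ∧ y 5 * y 3 = 0}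


theorem mono_aux {f f' : ℝ → ℝ} {s t : ℝ} (hst : s ≤ t)
    (h : ∀ r ∈ Icc s t, HasDerivAt f (f' r) r) (h0 : ∀ r ∈ Icc s t, 0 ≤ f' r) : f s ≤ f t := by
  have := monotoneOn_of_deriv_nonneg (convex_Icc s t)
    (fun r hr => (h r hr).continuousAt.continuousWithinAt)
    (fun r hr => (h r (interior_subset hr)).differentiableAt.differentiableWithinAt)
    (fun r hr => by rw [(h r (interior_subset hr)).deriv]; exact h0 r (interior_subset hr))
  exact this ⟨le_rfl, hst⟩ ⟨hst, le_rfl⟩ hst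

theorem gronwall_aux {E : Type*} [NormedAddCommGroup E] [NormedSpace ℝ E]
    {f f' : ℝ → E} {T L δ : ℝ} (hδ : 0 < δ) (hL : 0 ≤ L)
    (hd : ∀ r ∈ Icc 0 T, HasDerivAt f (f' r) r)
    (hb : ∀ r ∈ Icc 0 T, ‖f r‖ ≤ 1 → ‖f' r‖ ≤ L * ‖f r‖)
    (h0 : ‖f 0‖ ≤ δ) (h1 : δ * Real.exp ((L+1)*T) ≤ 1) (hT : 0 ≤ T) :
    ‖f T‖ ≤ δ * Real.exp ((L+1)*T) := by
  have hB : ∀ x : ℝ, HasDerivAt (fun r => δ * Real.exp ((L+1)*r))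
      (δ * (Real.exp ((L+1)*x) * (L+1))) x := by
    intro x
    have := (((hasDerivAt_id x).const_mul (L+1)).exp).const_mul δ
    simpa using this
  refine image_norm_le_of_norm_deriv_right_lt_deriv_boundary' (f := f) (f' := f') (a := 0) (b := T)
    (B := fun r => δ * Real.exp ((L+1)*r)) (B' := fun x => δ * (Real.exp ((L+1)*x) * (L+1)))
    (fun r hr => (hd r hr).continuousAt.continuousWithinAt)
    (fun r hr => (hd r ⟨hr.1, hr.2.le⟩).hasDerivWithinAt) (by simpa using h0)
    (fun r hr => (hB r).continuousAt.continuousWithinAt)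
    (fun r hr => (hB r).hasDerivWithinAt) ?_ ⟨hT, le_rfl⟩
  intro r hr hfr
  have hle : ‖f r‖ ≤ 1 := by
    rw [hfr]
    refine le_trans ?_ h1
    have : (L+1)*r ≤ (L+1)*T := mul_le_mul_of_nonneg_left hr.2.le (by linarith)
    exact mul_le_mul_of_nonneg_left (Real.exp_le_exp.2 this) hδ.le
  have h2 := hb r ⟨hr.1, hr.2.le⟩ hle
  rw [hfr] at h2
  have h3 : 0 < δ * Real.exp ((L+1)*r) := by positivity
  nlinarith

theorem flow_tendsto {E : Type*} [NormedAddCommGroup E] [NormedSpace ℝ E] [FiniteDimensional ℝ E]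
    {F : E → E} (hF : ContDiff ℝ 1 F) {X Y : ℝ → E}
    (hX : ∀ t ≤ 0, HasDerivAt X (F (X t)) t) (hY : ∀ t, HasDerivAt Y (F (Y t)) t)
    {s : ℕ → ℝ} (hs : Tendsto s atTop atBot) {t0 : ℝ}
    (h0 : Tendsto (fun k => X (s k)) atTop (𝓝 (Y t0))) (t : ℝ) :
    Tendsto (fun k => X (s k + t)) atTop (𝓝 (Y (t0 + t))) := by
  obtain ⟨σ, T, hσ, hT, rfl⟩ : ∃ σ T : ℝ, |σ| = 1 ∧ 0 ≤ T ∧ t = σ * T := by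
    rcases le_total 0 t with h | h
    · exact ⟨1, t, by simp, h, by simp⟩
    · exact ⟨-1, -t, by simp, by linarith, by simp⟩
  have hσ1 : σ ≤ 1 := hσ ▸ le_abs_self σ
  have hYc : Continuous Y := continuous_iff_continuousAt.2 fun t => (hY t).continuousAt
  obtain ⟨M, hM⟩ := ((isCompact_Icc (a := (0:ℝ)) (b := T)).image
    (f := fun r => Y (t0 + σ * r)) (by fun_prop)).isBounded.exists_norm_le
  obtain ⟨L, hL⟩ := (hF.contDiffOn (s := Metric.closedBall 0 (M+1))).exists_lipschitzOnWith
    one_ne_zero (convex_closedBall _ _) (isCompact_closedBall _ _)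
  have key : ∀ r ∈ Icc 0 T, ∀ x, ‖x - Y (t0 + σ * r)‖ ≤ 1 →
      ‖σ • F x - σ • F (Y (t0 + σ * r))‖ ≤ L * ‖x - Y (t0 + σ * r)‖ := by
    intro r hr x hx
    have h1 : ‖Y (t0 + σ * r)‖ ≤ M := hM _ ⟨r, hr, rfl⟩
    have h2 : ‖x‖ ≤ M + 1 := by
      have := norm_add_le (x - Y (t0 + σ * r)) (Y (t0 + σ * r))
      rw [sub_add_cancel] at this; linarith
    rw [← smul_sub, norm_smul, Real.norm_eq_abs, hσ, one_mul]
    exact hL.norm_sub_le (by simpa using h2) (by simp; linarith)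
  rw [Metric.tendsto_atTop] at h0 ⊢
  intro ε hε
  set e := Real.exp (((L:ℝ)+1)*T) with he
  have hepos : 0 < e := Real.exp_pos _
  set δ := min (ε/2) 1 / e with hδ
  have hδpos : 0 < δ := by positivity
  have hδe : δ * e = min (ε/2) 1 := by rw [hδ]; field_simp
  obtain ⟨N1, hN1⟩ := h0 δ hδpos
  obtain ⟨N2, hN2⟩ := (hs.eventually_le_atBot (-T)).exists_forall_of_atTop
  refine ⟨max N1 N2, fun k hk => ?_⟩
  have a1 := hN1 k (le_of_max_le_left hk)
  have a2 := hN2 k (le_of_max_le_right hk)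
  have g := gronwall_aux (f := fun r => X (s k + σ * r) - Y (t0 + σ * r))
    (f' := fun r => σ • F (X (s k + σ * r)) - σ • F (Y (t0 + σ * r)))
    (T := T) (L := L) (δ := δ) hδpos L.2 ?_ ?_ ?_ ?_ hT
  · rw [dist_eq_norm]
    refine lt_of_le_of_lt g ?_
    rw [← he, hδe]
    exact lt_of_le_of_lt (min_le_left _ _) (by linarith)
  · intro r hr
    have hl : ∀ u : ℝ, HasDerivAt (fun r => u + σ * r) σ r := by
      intro u
      simpa using ((hasDerivAt_id r).const_mul σ).const_add u
    have b1 : s k + σ * r ≤ 0 := by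
      have := mul_le_mul_of_nonneg_right hσ1 hr.1
      have := hr.2
      linarith
    exact ((hX _ b1).scomp r (hl _)).sub ((hY _).scomp r (hl _))
  · intro r hr h
    exact key r hr _ h
  · simp only [mul_zero, add_zero]
    rw [← dist_eq_norm]; exact a1.le
  · rw [← he, hδe]; exact min_le_right _ _

/-- First exit (backwards in time). -/
theorem first_exit {g : ℝ → ℝ} {τ : ℝ} (hg : ContinuousOn g (Iic τ)) (h0 : g τ < 0)
    (hex : ∃ t ≤ τ, 0 ≤ g t) : ∃ s ≤ τ, g s = 0 ∧ ∀ t ∈ Icc s τ, g t ≤ 0 := by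
  obtain ⟨t1, ht1, hgt1⟩ := hex
  have hgI : ContinuousOn g (Icc t1 τ) := hg.mono (fun x hx => hx.2)
  set A := Icc t1 τ ∩ g ⁻¹' (Ici 0) with hA
  have hAc : IsClosed A := hgI.preimage_isClosed_of_isClosed isClosed_Icc isClosed_Ici
  have hAcomp : IsCompact A := isCompact_Icc.of_isClosed_subset hAc inter_subset_left
  have hAne : A.Nonempty := ⟨t1, ⟨le_rfl, ht1⟩, hgt1⟩
  obtain ⟨s, hs⟩ := hAcomp.exists_isGreatest hAne
  have hsA := hs.1
  have hlt : ∀ t ∈ Ioc s τ, g t < 0 := by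
    intro t ht
    by_contra h
    push Not at h
    have : t ∈ A := ⟨⟨hsA.1.1.trans ht.1.le, ht.2⟩, h⟩
    exact absurd (hs.2 this) (not_le.2 ht.1)
  have hsτ : s < τ := by
    rcases lt_or_eq_of_le hsA.1.2 with h | h
    · exact h
    · have h2 : 0 ≤ g s := hsA.2
      rw [h] at h2; linarith
  have hs0 : g s ≤ 0 := by
    by_contra h
    push Not at h
    have hc : ContinuousOn g (Icc s τ) := hg.mono (fun x hx => hx.2)
    obtain ⟨c, hc1, hc2⟩ := intermediate_value_Icc' hsτ.le hc
      (show g s / 2 ∈ Icc (g τ) (g s) from ⟨by linarith, by linarith⟩)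
    rcases eq_or_lt_of_le hc1.1 with h2 | h2
    · subst h2; linarith
    · have := hlt c ⟨h2, hc1.2⟩; linarith
  refine ⟨s, hsτ.le, le_antisymm hs0 hsA.2, fun t ht => ?_⟩
  rcases eq_or_lt_of_le ht.1 with h2 | h2
  · rw [← h2]; exact hs0
  · exact (hlt t ⟨h2, ht.2⟩).le

/-- The good box around a Kasner point in `K₁`. -/
def GoodAt (γ c u v : ℝ) : Prop :=
  c ≤ 2*(u^2+v^2) + 2*u + 2*Real.sqrt 3*v ∧ c ≤ 2*(u^2+v^2) + 2*u - 2*Real.sqrt 3*v ∧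
  c ≤ 4*(u^2+v^2) - (3*γ-2) ∧ 2*(u^2+v^2) - 4*u ≤ -(2*c) ∧ 1/2 ≤ 2 - u ∧ |u| ≤ 2 ∧ |v| ≤ 2

theorem arc_ineq {a b : ℝ} (h1 : a^2+b^2 = 1) (ha : 1/2 < a) :
    0 < 1 + a + Real.sqrt 3*b ∧ 0 < 1 + a - Real.sqrt 3*b := by
  have h3 : Real.sqrt 3 ^2 = 3 := Real.sq_sqrt (by norm_num)
  have ha1 : a ≤ 1 := by nlinarith [sq_nonneg b]
  have hu : (Real.sqrt 3*b)^2 < (1+a)^2 := by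
    rw [mul_pow, h3]; nlinarith
  have := abs_lt_of_sq_lt_sq hu (by linarith)
  rw [abs_lt] at this
  constructor <;> linarith [this.1, this.2]

theorem good_box {γ a b : ℝ} (hγ2 : γ < 2) (h1 : a^2+b^2 = 1) (ha : 1/2 < a) :
    ∃ c > 0, ∃ η > 0, ∀ u v, |u-a| ≤ η → |v-b| ≤ η → GoodAt γ c u v := by
  obtain ⟨p1, p2⟩ := arc_ineq h1 ha
  have ha1 : a ≤ 1 := by nlinarith [sq_nonneg b]
  have hb1 : |b| ≤ 1 := by rw [abs_le]; constructor <;> nlinarith [sq_nonneg a]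
  obtain ⟨c, hc, c1, c2, c3, c4⟩ : ∃ c > 0, c < 2*(1 + a + Real.sqrt 3*b) ∧
      c < 2*(1 + a - Real.sqrt 3*b) ∧ c < 6 - 3*γ ∧ 2 * c < 4*a-2 := by
    refine ⟨min (min (1 + a + Real.sqrt 3*b) (1 + a - Real.sqrt 3*b)) (min ((6-3*γ)/2) (a-1/2)),
      ?_, ?_, ?_, ?_, ?_⟩
    · simp only [gt_iff_lt, lt_min_iff]
      exact ⟨⟨p1, p2⟩, by linarith, by linarith⟩
    · exact lt_of_le_of_lt ((min_le_left _ _).trans (min_le_left _ _)) (by linarith)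
    · exact lt_of_le_of_lt ((min_le_left _ _).trans (min_le_right _ _)) (by linarith)
    · exact lt_of_le_of_lt ((min_le_right _ _).trans (min_le_left _ _)) (by linarith)
    · have := (min_le_right (min (1 + a + Real.sqrt 3*b) (1 + a - Real.sqrt 3*b))
        (min ((6-3*γ)/2) (a-1/2))).trans (min_le_right _ _)
      linarith
  have ev : ∀ᶠ p : ℝ × ℝ in 𝓝 (a, b), GoodAt γ c p.1 p.2 := by
    unfold GoodAt
    refine .and ?_ (.and ?_ (.and ?_ (.and ?_ (.and ?_ (.and ?_ ?_)))))
    · exact (ContinuousAt.eventually_lt (f := fun _ => c)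
        (g := fun p : ℝ × ℝ => 2*(p.1^2+p.2^2) + 2*p.1 + 2*Real.sqrt 3*p.2)
        (by fun_prop) (by fun_prop) (by simp only; nlinarith)).mono fun _ h => h.le
    · exact (ContinuousAt.eventually_lt (f := fun _ => c)
        (g := fun p : ℝ × ℝ => 2*(p.1^2+p.2^2) + 2*p.1 - 2*Real.sqrt 3*p.2)
        (by fun_prop) (by fun_prop) (by simp only; nlinarith)).mono fun _ h => h.le
    · exact (ContinuousAt.eventually_lt (f := fun _ => c)
        (g := fun p : ℝ × ℝ => 4*(p.1^2+p.2^2) - (3*γ-2))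
        (by fun_prop) (by fun_prop) (by simp only; nlinarith)).mono fun _ h => h.le
    · exact (ContinuousAt.eventually_lt (g := fun _ => -(2*c))
        (f := fun p : ℝ × ℝ => 2*(p.1^2+p.2^2) - 4*p.1)
        (by fun_prop) (by fun_prop) (by simp only; nlinarith)).mono fun _ h => h.le
    · exact (ContinuousAt.eventually_lt (f := fun _ => (1/2:ℝ))
        (g := fun p : ℝ × ℝ => 2 - p.1)
        (by fun_prop) (by fun_prop) (by simp only; linarith)).mono fun _ h => h.le
    · exact (ContinuousAt.eventually_lt (g := fun _ => (2:ℝ))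
        (f := fun p : ℝ × ℝ => |p.1|)
        (by fun_prop) (by fun_prop) (by
          simp only; rw [abs_lt]; constructor <;> linarith)).mono fun _ h => h.le
    · exact (ContinuousAt.eventually_lt (g := fun _ => (2:ℝ))
        (f := fun p : ℝ × ℝ => |p.2|)
        (by fun_prop) (by fun_prop) (by simp only; linarith)).mono fun _ h => h.le
  obtain ⟨η, hη, H⟩ := Metric.eventually_nhds_iff.1 ev
  refine ⟨c, hc, η/2, by positivity, fun u v hu hv => H (y := (u, v)) ?_⟩
  rw [Prod.dist_eq, Real.dist_eq, Real.dist_eq]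
  exact max_lt (by simp only; linarith) (by simp only; linarith)

theorem E_rate {γ c O u v n2 n3 : ℝ} (hγ1 : 2/3 < γ) (hg : GoodAt γ c u v)
    (hO : 0 ≤ O) (h2 : 0 ≤ n2) (h3 : 0 ≤ n3) :
    c * (O + n2 + n3) ≤ (2 * qf γ O u v - (3*γ - 2)) * O
      + (qf γ O u v + 2 * u + 2 * Real.sqrt 3 * v) * n2
      + (qf γ O u v + 2 * u - 2 * Real.sqrt 3 * v) * n3 := by
  obtain ⟨g1, g2, g3, -⟩ := hg
  have hq : 2*(u^2+v^2) ≤ qf γ O u v := by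
    unfold qf; nlinarith [mul_nonneg (by linarith : 0 ≤ 3*γ-2) hO]
  have e1 : c * O ≤ (2 * qf γ O u v - (3*γ - 2)) * O :=
    mul_le_mul_of_nonneg_right (by linarith) hO
  have e2 : c * n2 ≤ (qf γ O u v + 2 * u + 2 * Real.sqrt 3 * v) * n2 :=
    mul_le_mul_of_nonneg_right (by linarith) h2
  have e3 : c * n3 ≤ (qf γ O u v + 2 * u - 2 * Real.sqrt 3 * v) * n3 :=
    mul_le_mul_of_nonneg_right (by linarith) h3
  linarith

theorem n1_le_two {O u v n1 n2 n3 : ℝ} (hc : Constraint O u v n1 n2 n3)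
    (hO : 0 ≤ O) (h1 : 0 ≤ n1) (h2 : 0 ≤ n2) (h3 : 0 ≤ n3) (hm : n2 + n3 ≤ 1/4) : n1 ≤ 2 := by
  unfold Constraint at hc
  by_contra h
  push Not at h
  nlinarith [sq_nonneg u, sq_nonneg v, sq_nonneg (n2-n3), mul_nonneg h1 (sub_nonneg.2 hm)]

theorem n1_rate {γ c O u v : ℝ} (hγ2 : γ < 2) (hg : GoodAt γ c u v)
    (hO : 0 ≤ O) (hO2 : 2 * O ≤ c) : qf γ O u v - 4*u ≤ -c := by
  obtain ⟨-, -, -, g4, -⟩ := hg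
  unfold qf
  nlinarith [mul_nonneg (by linarith : 0 ≤ 2-γ) hO]

theorem two_sub_q {γ O u v n1 n2 n3 : ℝ} (hc : Constraint O u v n1 n2 n3) :
    2 - qf γ O u v = (2 - (3*γ-2)/2) * O + (3/2) * n1^2 + (3/2)*(n2-n3)^2 - 3*n1*(n2+n3) := by
  unfold Constraint at hc; unfold qf; linarith

theorem abs_mul_le' {x y X Y : ℝ} (hx : |x| ≤ X) (hy : |y| ≤ Y) : |x*y| ≤ X*Y := by
  rw [abs_mul]; exact mul_le_mul hx hy (abs_nonneg _) ((abs_nonneg _).trans hx)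

theorem Sp_rate {γ c O u v n1 n2 n3 : ℝ} (hγ1 : 2/3 < γ) (hγ2 : γ < 2) (hg : GoodAt γ c u v)
    (hc : Constraint O u v n1 n2 n3)
    (hO : 0 ≤ O) (h1 : 0 ≤ n1) (h2 : 0 ≤ n2) (h3 : 0 ≤ n3) (hm : n2 + n3 ≤ 1/4) :
    0 ≤ -(2 - qf γ O u v) * u - 3 * SPf n1 n2 n3 + 300 * (O + n2 + n3) := by
  have hn := n1_le_two hc hO h1 h2 h3 hm
  obtain ⟨-, -, -, -, g5, g6, g7⟩ := hg
  rw [two_sub_q hc]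
  unfold SPf
  have hd : |(n2-n3)^2| ≤ n2 + n3 := by
    rw [abs_of_nonneg (sq_nonneg _)]; nlinarith
  have hnm : |n1*(n2+n3)| ≤ 2 * (n2+n3) := by
    rw [abs_of_nonneg (by positivity)]; exact mul_le_mul_of_nonneg_right hn (by positivity)
  have hgO : |(2 - (3*γ-2)/2) * O| ≤ 2 * O := by
    rw [abs_of_nonneg (mul_nonneg (by linarith) hO)]
    exact mul_le_mul_of_nonneg_right (by linarith) hO
  have A1 := abs_le.1 (abs_mul_le' hgO g6)
  have A2 := abs_le.1 (abs_mul_le' hd g6)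
  have A3 := abs_le.1 (abs_mul_le' hnm g6)
  have A4 : 0 ≤ n1^2 * (2-u) := mul_nonneg (sq_nonneg _) (by linarith)
  have A5 := abs_le.1 hd
  have A6 := abs_le.1 hnm
  nlinarith [A1.1, A1.2, A2.1, A2.2, A3.1, A3.2, A5.1, A5.2, A6.1, A6.2]

theorem R_rate {γ c O u v n1 n2 n3 : ℝ} (hγ1 : 2/3 < γ) (hγ2 : γ < 2) (hg : GoodAt γ c u v)
    (hc : Constraint O u v n1 n2 n3)
    (hO : 0 ≤ O) (h1 : 0 ≤ n1) (h2 : 0 ≤ n2) (h3 : 0 ≤ n3) (hm : n2 + n3 ≤ 1/4) :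
    |((-(2 - qf γ O u v) * v - 3 * SMf n1 n2 n3) * (2 - u) -
      v * (0 - (-(2 - qf γ O u v) * u - 3 * SPf n1 n2 n3))) / (2-u)^2| ≤ 300 * (O + n2 + n3) := by
  have hn := n1_le_two hc hO h1 h2 h3 hm
  obtain ⟨-, -, -, -, g5, g6, g7⟩ := hg
  have hu4 : |2-u| ≤ 4 := by have := abs_le.1 g6; rw [abs_le]; constructor <;> linarith
  have hd : |(n2-n3)^2| ≤ n2 + n3 := by
    rw [abs_of_nonneg (sq_nonneg _)]; nlinarith
  have hnm : |n1*(n2+n3)| ≤ 2 * (n2+n3) := by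
    rw [abs_of_nonneg (by positivity)]; exact mul_le_mul_of_nonneg_right hn (by positivity)
  have hgO : |(2 - (3*γ-2)/2) * O| ≤ 2 * O := by
    rw [abs_of_nonneg (mul_nonneg (by linarith) hO)]
    exact mul_le_mul_of_nonneg_right (by linarith) hO
  have h3s : |Real.sqrt 3 / 2| ≤ 1 := by
    have h0 : 0 ≤ Real.sqrt 3 := Real.sqrt_nonneg 3
    have : Real.sqrt 3 ≤ 2 := by
      rw [Real.sqrt_le_left (by norm_num)]; norm_num
    rw [abs_of_nonneg (by positivity)]; linarith
  have hS : |SMf n1 n2 n3| ≤ 3 * (n2+n3) := by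
    unfold SMf
    have i1 : |n3 - n2| ≤ n2+n3 := by rw [abs_le]; constructor <;> linarith
    have i2 : |n1 - n2 - n3| ≤ 3 := by rw [abs_le]; constructor <;> linarith
    have := abs_mul_le' (abs_mul_le' h3s i1) i2
    linarith
  have A1 := abs_le.1 (abs_mul_le' hgO g7)
  have A2 := abs_le.1 (abs_mul_le' hd g7)
  have A3 := abs_le.1 (abs_mul_le' hnm g7)
  have A4 := abs_le.1 (abs_mul_le' hS hu4)
  have num : (-(2 - qf γ O u v) * v - 3 * SMf n1 n2 n3) * (2 - u) -
      v * (0 - (-(2 - qf γ O u v) * u - 3 * SPf n1 n2 n3)) =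
      -2 * ((2 - (3*γ-2)/2) * O * v) - (9/2) * ((n2-n3)^2 * v) + (9/2) * (n1*(n2+n3)*v)
      - 3 * (SMf n1 n2 n3 * (2-u)) := by
    rw [two_sub_q hc]; unfold SPf; ring
  have hpos : 0 < (2-u)^2 := by have : 0 < 2-u := by linarith
                                positivity
  have hq : 1/4 ≤ (2-u)^2 := by nlinarith
  rw [num, abs_div, abs_of_pos hpos, div_le_iff₀ hpos]
  have : 300 * (O + n2 + n3) * (1/4) ≤ 300 * (O+n2+n3) * (2-u)^2 :=
    mul_le_mul_of_nonneg_left hq (by positivity)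
  refine le_trans ?_ this
  rw [abs_le]
  constructor <;> linarith [A1.1, A1.2, A2.1, A2.2, A3.1, A3.2, A4.1, A4.2]

section apriori

variable {γ c : ℝ} {O Sp Sm n1 n2 n3 : ℝ → ℝ}

theorem apriori (hγ1 : 2/3 < γ) (hγ2 : γ < 2) (hc : 0 < c)
    (hsol : SolOn γ (Set.Iic 0) O Sp Sm n1 n2 n3)
    (hIX : ∀ τ ∈ Set.Iic (0:ℝ), 0 < n1 τ ∧ 0 < n2 τ ∧ 0 < n3 τ)
    {s τ : ℝ} (hτ : τ ≤ 0) (hs : s ≤ τ) (hg : ∀ t ∈ Icc s τ, GoodAt γ c (Sp t) (Sm t))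
    (hE1 : O τ + n2 τ + n3 τ ≤ 1/4) (hE2 : 2 * (O τ + n2 τ + n3 τ) ≤ c) :
    O s + n2 s + n3 s ≤ O τ + n2 τ + n3 τ ∧
    Sp s ≤ Sp τ + 300 / c * (O τ + n2 τ + n3 τ) ∧
    |Sm s / (2 - Sp s) - Sm τ / (2 - Sp τ)| ≤ 300 / c * (O τ + n2 τ + n3 τ) ∧
    n1 τ + c * n1 τ * (τ - s) ≤ n1 s ∧ n1 s ≤ 2 := by
  have dE : ∀ t ∈ Icc s τ, HasDerivAt (fun t => O t + n2 t + n3 t) _ t := fun t ht =>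
    ((hsol.hO t (ht.2.trans hτ)).add (hsol.hn2 t (ht.2.trans hτ))).add (hsol.hn3 t (ht.2.trans hτ))
  have rE : ∀ t ∈ Icc s τ, _ := fun t ht => E_rate hγ1 (hg t ht) (hsol.hOnn t (ht.2.trans hτ))
    (hIX t (ht.2.trans hτ)).2.1.le (hIX t (ht.2.trans hτ)).2.2.le
  have pE : ∀ t ∈ Icc s τ, 0 ≤ O t + n2 t + n3 t := fun t ht => by
    have := hsol.hOnn t (ht.2.trans hτ)
    have := hIX t (ht.2.trans hτ)
    linarith
  have mE : ∀ t ∈ Icc s τ, O t + n2 t + n3 t ≤ O τ + n2 τ + n3 τ := fun t ht =>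
    mono_aux (f := fun t => O t + n2 t + n3 t) ht.2
      (fun r hr => dE r ⟨ht.1.trans hr.1, hr.2⟩)
      (fun r hr => (mul_nonneg hc.le (pE r ⟨ht.1.trans hr.1, hr.2⟩)).trans
        (rE r ⟨ht.1.trans hr.1, hr.2⟩))
  have hss : s ∈ Icc s τ := ⟨le_rfl, hs⟩
  have hK : 0 < 300 / c := by positivity
  have hKc : 300 / c * c = 300 := by field_simp
  have hm : ∀ t ∈ Icc s τ, n2 t + n3 t ≤ 1/4 := fun t ht => by
    have := mE t ht; have := hsol.hOnn t (ht.2.trans hτ); linarith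
  have kE : ∀ t ∈ Icc s τ, 300 * (O t + n2 t + n3 t) ≤ 300 / c * _ := fun t ht => by
    have := mul_le_mul_of_nonneg_left (rE t ht) hK.le
    rw [← mul_assoc, hKc] at this
    exact this
  have dR : ∀ t ∈ Icc s τ, HasDerivAt (fun t => Sm t / (2 - Sp t)) _ t := fun t ht =>
    (hsol.hSm t (ht.2.trans hτ)).div ((hasDerivAt_const t (2:ℝ)).sub (hsol.hSp t (ht.2.trans hτ)))
      (by have := (hg t ht).2.2.2.2.1; linarith)
  have rR : ∀ t ∈ Icc s τ, _ := fun t ht => abs_le.1 <| R_rate hγ1 hγ2 (hg t ht)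
    (hsol.hcon t (ht.2.trans hτ)) (hsol.hOnn t (ht.2.trans hτ)) (hIX t (ht.2.trans hτ)).1.le
    (hIX t (ht.2.trans hτ)).2.1.le (hIX t (ht.2.trans hτ)).2.2.le (hm t ht)
  have n1r : ∀ t ∈ Icc s τ, qf γ (O t) (Sp t) (Sm t) - 4 * Sp t ≤ -c := fun t ht =>
    n1_rate hγ2 (hg t ht) (hsol.hOnn t (ht.2.trans hτ)) (by
      have := mE t ht; have := hIX t (ht.2.trans hτ); linarith)
  have n1m : ∀ t ∈ Icc s τ, n1 τ ≤ n1 t := fun t ht => by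
    have := mono_aux (f := fun t => - n1 t) ht.2
      (fun r hr => (hsol.hn1 r (hr.2.trans hτ)).neg) (fun r hr => by
        have h1 := n1r r ⟨ht.1.trans hr.1, hr.2⟩
        have h2 := (hIX r (hr.2.trans hτ)).1
        nlinarith)
    linarith
  refine ⟨mE s hss, ?_, ?_, ?_, ?_⟩
  · have := mono_aux (f := fun t => Sp t + 300 / c * (O t + n2 t + n3 t)) hs
      (fun t ht => (hsol.hSp t (ht.2.trans hτ)).add ((dE t ht).const_mul (300/c)))
      (fun t ht => by
        have h1 := Sp_rate hγ1 hγ2 (hg t ht)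
          (hsol.hcon t (ht.2.trans hτ)) (hsol.hOnn t (ht.2.trans hτ)) (hIX t (ht.2.trans hτ)).1.le
          (hIX t (ht.2.trans hτ)).2.1.le (hIX t (ht.2.trans hτ)).2.2.le (hm t ht)
        have h2 := kE t ht
        linarith)
    have h2 := mul_nonneg hK.le (pE s hss)
    linarith
  · have m1 := mono_aux (f := fun t => Sm t / (2 - Sp t) + 300 / c * (O t + n2 t + n3 t)) hs
      (fun t ht => (dR t ht).add ((dE t ht).const_mul (300/c)))
      (fun t ht => by
        have h1 := rR t ht
        have h2 := kE t ht
        linarith [h1.1])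
    have m2 := mono_aux (f := fun t => - (Sm t / (2 - Sp t)) + 300 / c * (O t + n2 t + n3 t)) hs
      (fun t ht => (dR t ht).neg.add ((dE t ht).const_mul (300/c)))
      (fun t ht => by
        have h1 := rR t ht
        have h2 := kE t ht
        linarith [h1.2])
    have h2 := mul_nonneg hK.le (pE s hss)
    rw [abs_le]
    constructor <;> linarith
  · have := mono_aux (f := fun t => - n1 t - c * n1 τ * t) hs
      (fun t ht => (hsol.hn1 t (ht.2.trans hτ)).neg.sub ((hasDerivAt_id t).const_mul (c * n1 τ)))
      (fun t ht => by
        have h1 := n1r t ht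
        have h2 := n1m t ht
        have h3 := (hIX t (ht.2.trans hτ)).1
        nlinarith)
    linarith
  · have hs0 := hs.trans hτ
    exact n1_le_two (hsol.hcon s hs0) (hsol.hOnn s hs0) (hIX s hs0).1.le
      (hIX s hs0).2.1.le (hIX s hs0).2.2.le (hm s hss)

theorem exit_time {a b w η : ℝ} (hγ1 : 2/3 < γ) (hγ2 : γ < 2) (hc : 0 < c)
    (hab : a^2+b^2 = 1) (ha : 1/2 < a) (hη : 0 < η)
    (hbox : ∀ u v, |u-a| ≤ η → |v-b| ≤ η → GoodAt γ c u v)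
    (hsol : SolOn γ (Set.Iic 0) O Sp Sm n1 n2 n3)
    (hIX : ∀ τ ∈ Set.Iic (0:ℝ), 0 < n1 τ ∧ 0 < n2 τ ∧ 0 < n3 τ)
    (hw1 : a - η/2 < w) (hwa : w < a)
    {τ : ℝ} (hτ : τ ≤ 0)
    (hE1 : O τ + n2 τ + n3 τ ≤ 1/4) (hE2 : 2 * (O τ + n2 τ + n3 τ) ≤ c)
    (hSp1 : w < Sp τ) (hSp2 : Sp τ + 300 / c * (O τ + n2 τ + n3 τ) < a + η/2)
    (hSm : |Sm τ - b| < η)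
    (hR : |Sm τ / (2 - Sp τ) - b / (2 - a)| + 300 / c * (O τ + n2 τ + n3 τ) < η/16) :
    ∃ s ≤ τ, Sp s = w ∧ O s + n2 s + n3 s ≤ O τ + n2 τ + n3 τ ∧
      |Sm s / (2 - Sp s) - Sm τ / (2 - Sp τ)| ≤ 300 / c * (O τ + n2 τ + n3 τ) := by
  have hE0 : 0 ≤ O τ + n2 τ + n3 τ := by
    have := hsol.hOnn τ hτ
    have := hIX τ hτ
    linarith
  have hK : 0 ≤ 300 / c * (O τ + n2 τ + n3 τ) := by positivity
  set g : ℝ → ℝ := fun t => max (w - Sp t) (max (Sp t - (a + η/2)) (|Sm t - b| - η)) with hgdef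
  have hgood : ∀ t, g t ≤ 0 → GoodAt γ c (Sp t) (Sm t) := by
    intro t ht
    rw [hgdef] at ht
    simp only [max_le_iff] at ht
    refine hbox _ _ ?_ (by linarith [ht.2.2])
    rw [abs_le]; constructor <;> linarith [ht.1, ht.2.1]
  have hcont : ContinuousOn g (Iic τ) := by
    have c1 : ContinuousOn Sp (Iic τ) := fun t ht =>
      (hsol.hSp t (le_trans ht hτ)).continuousAt.continuousWithinAt
    have c2 : ContinuousOn Sm (Iic τ) := fun t ht =>
      (hsol.hSm t (le_trans ht hτ)).continuousAt.continuousWithinAt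
    fun_prop
  have hgτ : g τ < 0 := by
    simp only [hgdef, max_lt_iff]
    exact ⟨by linarith, by linarith, by linarith⟩
  have hex : ∃ t ≤ τ, 0 ≤ g t := by
    by_contra hcon
    push Not at hcon
    have hn := (hIX τ hτ).1
    have hcn : 0 < c * n1 τ := by positivity
    have hsle : τ - 2 / (c * n1 τ) ≤ τ := by
      have : 0 < 2 / (c * n1 τ) := by positivity
      linarith
    obtain ⟨-, -, -, h1, h2⟩ := apriori hγ1 hγ2 hc hsol hIX hτ hsle
      (fun t ht => hgood t (hcon t ht.2).le) hE1 hE2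
    have : c * n1 τ * (τ - (τ - 2 / (c * n1 τ))) = 2 := by field_simp; ring
    rw [this] at h1
    linarith
  obtain ⟨s, hs, hgs, hall⟩ := first_exit hcont hgτ hex
  obtain ⟨e1, e2, e3, -, -⟩ := apriori hγ1 hγ2 hc hsol hIX hτ hs
      (fun t ht => hgood t (hall t ht)) hE1 hE2
  refine ⟨s, hs, ?_, e1, e3⟩
  have hgs' := hgs.le
  simp only [hgdef, max_le_iff] at hgs'
  have ha1 : a ≤ 1 := by nlinarith [sq_nonneg b]
  have hb1 : |b| ≤ 1 := by rw [abs_le]; constructor <;> nlinarith [sq_nonneg a]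
  have h2a : 1 ≤ 2 - a := by linarith
  have hρ : |b / (2-a)| ≤ 1 := by
    have hp : 0 < 2 - a := by linarith
    rw [abs_div, abs_of_pos hp, div_le_one hp]; linarith
  have gs := hgood s hgs.le
  have h2s : 0 < 2 - Sp s := by have := gs.2.2.2.2.1; linarith
  have h4 : |2 - Sp s| ≤ 4 := by
    have := abs_le.1 gs.2.2.2.2.2.1; rw [abs_le]; constructor <;> linarith
  have hRs : |Sm s / (2 - Sp s) - b / (2-a)| ≤ η/16 := by
    have := abs_sub_le (Sm s / (2 - Sp s)) (Sm τ / (2 - Sp τ)) (b / (2-a))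
    linarith
  have hSma : |a - Sp s| ≤ η/2 := by rw [abs_le]; constructor <;> linarith [hgs'.1, hgs'.2.1]
  have heq : Sm s - b = (Sm s / (2 - Sp s) - b / (2-a)) * (2 - Sp s) + b/(2-a) * (a - Sp s) := by
    have : 2 - a ≠ 0 := by linarith
    field_simp; ring
  have hlt : |Sm s - b| < η := by
    rw [heq]
    have i1 := abs_mul_le' hRs h4
    have i2 := abs_mul_le' hρ hSma
    have i3 := abs_add_le ((Sm s / (2 - Sp s) - b / (2-a)) * (2 - Sp s)) (b/(2-a) * (a - Sp s))
    linarith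
  by_contra hne
  have : g s < 0 := by
    simp only [hgdef, max_lt_iff]
    refine ⟨?_, by linarith, by linarith⟩
    rcases lt_or_eq_of_le hgs'.1 with h | h
    · exact h
    · exact absurd (by linarith) hne
  linarith

end apriori

/-- The Wainwright–Hsu vector field on `ℝ⁶`. -/
def field (γ : ℝ) (x : Fin 6 → ℝ) : Fin 6 → ℝ :=
  ![(2 * qf γ (x 0) (x 1) (x 2) - (3*γ - 2)) * x 0,
    -(2 - qf γ (x 0) (x 1) (x 2)) * x 1 - 3 * SPf (x 3) (x 4) (x 5),
    -(2 - qf γ (x 0) (x 1) (x 2)) * x 2 - 3 * SMf (x 3) (x 4) (x 5),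
    (qf γ (x 0) (x 1) (x 2) - 4 * x 1) * x 3,
    (qf γ (x 0) (x 1) (x 2) + 2 * x 1 + 2 * Real.sqrt 3 * x 2) * x 4,
    (qf γ (x 0) (x 1) (x 2) + 2 * x 1 - 2 * Real.sqrt 3 * x 2) * x 5]

theorem field_contDiff (γ : ℝ) : ContDiff ℝ 1 (field γ) := by
  rw [contDiff_pi]
  intro i
  fin_cases i <;> simp [field, qf, SPf, SMf] <;> fun_prop

theorem SolOn.hasDerivAt_vec {γ : ℝ} {S : Set ℝ} {O Sp Sm n1 n2 n3 : ℝ → ℝ}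
    (h : SolOn γ S O Sp Sm n1 n2 n3) {t : ℝ} (ht : t ∈ S) :
    HasDerivAt (fun t => (![O t, Sp t, Sm t, n1 t, n2 t, n3 t] : Fin 6 → ℝ))
      (field γ ![O t, Sp t, Sm t, n1 t, n2 t, n3 t]) t := by
  rw [hasDerivAt_pi]
  intro i
  fin_cases i
  · exact h.hO t ht
  · exact h.hSp t ht
  · exact h.hSm t ht
  · exact h.hn1 t ht
  · exact h.hn2 t ht
  · exact h.hn3 t ht

theorem case1 {γ : ℝ} (hγ1 : 2/3 < γ) (hγ2 : γ < 2)
    {O Sp Sm n1 n2 n3 : ℝ → ℝ}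
    (hsol : SolOn γ (Set.Iic 0) O Sp Sm n1 n2 n3)
    (hIX : ∀ τ ∈ Set.Iic (0:ℝ), 0 < n1 τ ∧ 0 < n2 τ ∧ 0 < n3 τ)
    {a b : ℝ} (hab : a^2 + b^2 = 1) (ha : 1/2 < a)
    (hlim : AlphaLim O Sp Sm n1 n2 n3 0 a b 0 0 0)
    {Oy Spy Smy m1 m2 m3 : ℝ → ℝ}
    (hy : SolOn γ Set.univ Oy Spy Smy m1 m2 m3)
    (hOy : ∀ t, Oy t = 0) (hm1 : ∀ t, 0 < m1 t) (hm2 : ∀ t, m2 t = 0) (hm3 : ∀ t, m3 t = 0)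
    (hom : OmegaLim Oy Spy Smy m1 m2 m3 0 a b 0 0 0) (t : ℝ) :
    AlphaLim O Sp Sm n1 n2 n3 (Oy t) (Spy t) (Smy t) (m1 t) (m2 t) (m3 t) := by
  have ha1 : a ≤ 1 := by nlinarith [sq_nonneg b]
  have ycon : ∀ t, Spy t ^2 + Smy t^2 + 3/4 * m1 t^2 = 1 := by
    intro t
    have := hy.hcon t (mem_univ t)
    unfold Constraint at this
    rw [hOy, hm2, hm3] at this
    linarith
  have ySp1 : ∀ t, Spy t < 1 := by
    intro t
    have := ycon t
    have := hm1 t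
    nlinarith [sq_nonneg (Smy t), sq_nonneg (Spy t - 1), mul_pos this this]
  have yq : ∀ t, 2 - qf γ (Oy t) (Spy t) (Smy t) = 3/2 * m1 t^2 := by
    intro t
    rw [two_sub_q (hy.hcon t (mem_univ t)), hOy, hm2, hm3]; ring
  have dSpy : ∀ t, HasDerivAt Spy (3/2 * m1 t^2 * (2 - Spy t)) t := by
    intro t
    have := hy.hSp t (mem_univ t)
    rw [yq t, hm2, hm3] at this
    convert this using 1
    unfold SPf; ring
  have dSmy : ∀ t, HasDerivAt Smy (-(3/2 * m1 t^2) * Smy t) t := by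
    intro t
    have := hy.hSm t (mem_univ t)
    rw [yq t, hm2, hm3] at this
    convert this using 1
    unfold SMf; ring
  have ymono : StrictMono Spy := by
    apply strictMono_of_deriv_pos
    intro t
    rw [(dSpy t).deriv]
    have h1 := hm1 t
    have h2 : 0 < 2 - Spy t := by linarith [ySp1 t]
    positivity
  have dR : ∀ t, HasDerivAt (fun t => Smy t / (2 - Spy t)) 0 t := by
    intro t
    have h2 : 2 - Spy t ≠ 0 := by linarith [ySp1 t]
    have := (dSmy t).div ((hasDerivAt_const t (2:ℝ)).sub (dSpy t)) h2
    refine HasDerivAt.congr_deriv this ?_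
    rw [div_eq_zero_iff]; left
    simp only [Pi.sub_apply]
    ring
  obtain ⟨ys, hys, -, yl1, yl2, -, -, -⟩ := hom
  have yR : ∀ t, Smy t / (2 - Spy t) = b / (2 - a) := by
    intro t
    have hconst : ∀ r, Smy r / (2 - Spy r) = Smy t / (2 - Spy t) := fun r =>
      is_const_of_deriv_eq_zero (f := fun t => Smy t / (2 - Spy t))
        (fun r => (dR r).differentiableAt) (fun r => (dR r).deriv) r t
    have hl : Tendsto (fun k => Smy (ys k) / (2 - Spy (ys k))) atTop (𝓝 (b / (2-a))) :=
      yl2.div (tendsto_const_nhds.sub yl1) (by linarith)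
    simp only [hconst] at hl
    exact tendsto_nhds_unique tendsto_const_nhds hl
  have yla : ∀ t, Spy t < a := by
    intro t
    refine lt_of_lt_of_le (ymono (lt_add_one t)) (ge_of_tendsto yl1 ?_)
    filter_upwards [hys.eventually_ge_atTop (t+1)] with k hk using ymono.monotone hk
  obtain ⟨c, hc, η, hη, hbox⟩ := good_box hγ2 hab ha
  obtain ⟨k0, hk0⟩ := (yl1.eventually_const_lt (show a - η/2 < a by linarith)).exists
  set t0 := ys k0
  obtain ⟨τs, hτs, lO, lSp, lSm, -, ln2, ln3⟩ := hlim
  have lE : Tendsto (fun k => O (τs k) + n2 (τs k) + n3 (τs k)) atTop (𝓝 0) := by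
    simpa using (lO.add ln2).add ln3
  have lKE : Tendsto (fun k => 300 / c * (O (τs k) + n2 (τs k) + n3 (τs k))) atTop (𝓝 0) := by
    simpa using lE.const_mul (300/c)
  have lR : Tendsto (fun k => Sm (τs k) / (2 - Sp (τs k))) atTop (𝓝 (b / (2-a))) :=
    lSm.div (tendsto_const_nhds.sub lSp) (by linarith)
  have evs : ∀ᶠ k in atTop, ∃ s, s ≤ τs k ∧ Sp s = Spy t0 ∧
      O s + n2 s + n3 s ≤ O (τs k) + n2 (τs k) + n3 (τs k) ∧
      |Sm s / (2 - Sp s) - Sm (τs k) / (2 - Sp (τs k))|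
        ≤ 300 / c * (O (τs k) + n2 (τs k) + n3 (τs k)) := by
    have q1 : Tendsto (fun k => |Sm (τs k) - b|) atTop (𝓝 0) := by
      simpa using (lSm.sub_const b).abs
    have q2 : Tendsto (fun k => |Sm (τs k) / (2 - Sp (τs k)) - b / (2-a)|
        + 300 / c * (O (τs k) + n2 (τs k) + n3 (τs k))) atTop (𝓝 0) := by
      simpa using (lR.sub_const (b/(2-a))).abs.add lKE
    have q3 := lSp.add lKE
    rw [add_zero] at q3
    filter_upwards [hτs.eventually_le_atBot 0,
      lE.eventually_le_const (show (0:ℝ) < 1/4 by norm_num),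
      lE.eventually_le_const (show 0 < c/2 by positivity),
      lSp.eventually_const_lt (yla t0), q3.eventually_lt_const (show a < a + η/2 by linarith),
      q1.eventually_lt_const hη, q2.eventually_lt_const (show 0 < η/16 by positivity)]
      with k k1 k2 k3 k4 k5 k6 k7
    exact exit_time hγ1 hγ2 hc hab ha hη hbox hsol hIX hk0 (yla t0) k1 k2 (by linarith) k4 k5 k6 k7
  obtain ⟨s, hs⟩ := Filter.skolem.1 evs
  have hsbot : Tendsto s atTop atBot := tendsto_atBot_mono' _ (hs.mono fun k h => h.1) hτs
  have hs0 : ∀ᶠ k in atTop, s k ≤ 0 := hsbot.eventually_le_atBot 0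
  have nn : ∀ᶠ k in atTop, 0 ≤ O (s k) ∧ 0 ≤ n1 (s k) ∧ 0 ≤ n2 (s k) ∧ 0 ≤ n3 (s k) :=
    hs0.mono fun k h => ⟨hsol.hOnn _ h, (hIX _ h).1.le, (hIX _ h).2.1.le, (hIX _ h).2.2.le⟩
  have sO : Tendsto (fun k => O (s k)) atTop (𝓝 0) :=
    tendsto_of_tendsto_of_tendsto_of_le_of_le' tendsto_const_nhds lE
      (nn.mono fun k h => h.1) (by filter_upwards [nn, hs] with k h h'; linarith [h'.2.2.1])
  have sn2 : Tendsto (fun k => n2 (s k)) atTop (𝓝 0) :=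
    tendsto_of_tendsto_of_tendsto_of_le_of_le' tendsto_const_nhds lE
      (nn.mono fun k h => h.2.2.1) (by filter_upwards [nn, hs] with k h h'; linarith [h'.2.2.1])
  have sn3 : Tendsto (fun k => n3 (s k)) atTop (𝓝 0) :=
    tendsto_of_tendsto_of_tendsto_of_le_of_le' tendsto_const_nhds lE
      (nn.mono fun k h => h.2.2.2) (by filter_upwards [nn, hs] with k h h'; linarith [h'.2.2.1])
  have sSp : Tendsto (fun k => Sp (s k)) atTop (𝓝 (Spy t0)) :=
    tendsto_const_nhds.congr' (hs.mono fun k h => h.2.1.symm)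
  have sR : Tendsto (fun k => Sm (s k) / (2 - Sp (s k))) atTop (𝓝 (b / (2-a))) := by
    have : Tendsto (fun k => Sm (s k) / (2 - Sp (s k)) - Sm (τs k) / (2 - Sp (τs k)))
        atTop (𝓝 0) :=
      squeeze_zero_norm' (hs.mono fun k h => h.2.2.2) lKE
    simpa using this.add lR
  have h2y : 2 - Spy t0 ≠ 0 := by linarith [ySp1 t0]
  have sSm : Tendsto (fun k => Sm (s k)) atTop (𝓝 (Smy t0)) := by
    have h1 : Tendsto (fun k => Sm (s k) / (2 - Sp (s k)) * (2 - Sp (s k))) atTop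
        (𝓝 (b / (2-a) * (2 - Spy t0))) := sR.mul (tendsto_const_nhds.sub sSp)
    rw [← yR t0, div_mul_cancel₀ _ h2y] at h1
    refine h1.congr' (hs.mono fun k h => ?_)
    rw [h.2.1, div_mul_cancel₀ _ h2y]
  have sn1 : Tendsto (fun k => n1 (s k)) atTop (𝓝 (m1 t0)) := by
    have h1 : Tendsto (fun k => (4/3) * (1 - O (s k) - Sp (s k)^2 - Sm (s k)^2)
        + 4 * n2 (s k) * n3 (s k)) atTop
        (𝓝 ((4/3) * (1 - 0 - Spy t0^2 - Smy t0^2) + 4 * 0 * 0)) :=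
      ((((tendsto_const_nhds.sub sO).sub (sSp.pow 2)).sub (sSm.pow 2)).const_mul _).add
        ((sn2.const_mul 4).mul sn3)
    have h2 : (4/3) * (1 - 0 - Spy t0^2 - Smy t0^2) + 4 * 0 * 0 = m1 t0^2 := by
      have := ycon t0; linarith
    rw [h2] at h1
    have h3 : Tendsto (fun k => (n1 (s k) - (n2 (s k) + n3 (s k)))^2) atTop (𝓝 (m1 t0^2)) := by
      refine h1.congr' (hs0.mono fun k h => ?_)
      have := hsol.hcon _ h
      unfold Constraint at this
      linarith
    have h4 := h3.sqrt
    simp only [Real.sqrt_sq_eq_abs, abs_of_pos (hm1 t0)] at h4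
    have h5 : Tendsto (fun k => n1 (s k) - |n1 (s k) - (n2 (s k) + n3 (s k))|) atTop (𝓝 0) := by
      refine squeeze_zero_norm' (nn.mono fun k h => ?_) (by simpa using sn2.add sn3)
      rw [Real.norm_eq_abs]
      have := abs_abs_sub_abs_le_abs_sub (n1 (s k)) (n1 (s k) - (n2 (s k) + n3 (s k)))
      rw [abs_of_nonneg h.2.1, sub_sub_cancel, abs_of_nonneg (by linarith [h.2.2.1, h.2.2.2] :
        0 ≤ n2 (s k) + n3 (s k))] at this
      exact this
    simpa using h5.add h4
  have hX0 : Tendsto (fun k => (fun t => (![O t, Sp t, Sm t, n1 t, n2 t, n3 t] : Fin 6 → ℝ)) (s k))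
      atTop (𝓝 ((fun t => (![Oy t, Spy t, Smy t, m1 t, m2 t, m3 t] : Fin 6 → ℝ)) t0)) := by
    rw [tendsto_pi_nhds]
    intro i
    fin_cases i
    · simpa [hOy] using sO
    · simpa using sSp
    · simpa using sSm
    · simpa using sn1
    · simpa [hm2] using sn2
    · simpa [hm3] using sn3
  have fin := flow_tendsto (field_contDiff γ)
    (X := fun t => (![O t, Sp t, Sm t, n1 t, n2 t, n3 t] : Fin 6 → ℝ))
    (Y := fun t => (![Oy t, Spy t, Smy t, m1 t, m2 t, m3 t] : Fin 6 → ℝ))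
    (fun t ht => hsol.hasDerivAt_vec ht) (fun t => hy.hasDerivAt_vec (mem_univ t))
    hsbot hX0 (t - t0)
  rw [tendsto_pi_nhds] at fin
  refine ⟨fun k => s k + (t - t0), tendsto_atBot_add_const_right _ _ hsbot, ?_⟩
  have ht : t0 + (t - t0) = t := by ring
  have f0 := fin 0
  have f1 := fin 1
  have f2 := fin 2
  have f3 := fin 3
  have f4 := fin 4
  have f5 := fin 5
  simp only [ht] at f0 f1 f2 f3 f4 f5
  exact ⟨f0, f1, f2, f3, f4, f5⟩

/-- Rotation symmetry of the system. -/
theorem SolOn.rot {γ : ℝ} {S : Set ℝ} {O Sp Sm n1 n2 n3 : ℝ → ℝ}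
    (h : SolOn γ S O Sp Sm n1 n2 n3) :
    SolOn γ S O (fun t => -(1/2) * Sp t - Real.sqrt 3/2 * Sm t)
      (fun t => Real.sqrt 3/2 * Sp t - 1/2 * Sm t) n2 n3 n1 := by
  have h3 : Real.sqrt 3 ^2 = 3 := Real.sq_sqrt (by norm_num)
  have hq : ∀ O u v : ℝ, qf γ O (-(1/2) * u - Real.sqrt 3/2 * v)
      (Real.sqrt 3/2 * u - 1/2 * v) = qf γ O u v := by
    intro O u v; unfold qf
    linear_combination (1/2) * (u^2+v^2) * h3
  constructor
  · intro t ht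
    rw [hq]; convert h.hn2 t ht using 1; ring
  · intro t ht
    rw [hq]; convert h.hn3 t ht using 1; linear_combination (Sp t * n3 t) * h3
  · intro t ht
    rw [hq]; convert h.hn1 t ht using 1; linear_combination (- Sp t * n1 t) * h3
  · intro t ht
    rw [hq]
    refine (((h.hSp t ht).const_mul (-(1/2))).sub
      ((h.hSm t ht).const_mul (Real.sqrt 3/2))).congr_deriv ?_
    unfold SPf SMf
    linear_combination ((3/4) * (n3 t - n2 t) * (n1 t - n2 t - n3 t)) * h3
  · intro t ht
    rw [hq]
    refine (((h.hSp t ht).const_mul (Real.sqrt 3/2)).sub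
      ((h.hSm t ht).const_mul (1/2))).congr_deriv ?_
    unfold SPf SMf
    ring
  · intro t ht
    rw [hq]; exact h.hO t ht
  · exact h.hOnn
  · intro t ht
    have := h.hcon t ht
    unfold Constraint at this ⊢
    linear_combination this + (1/4) * (Sp t^2 + Sm t^2) * h3

theorem AlphaLim.rot {O Sp Sm n1 n2 n3 : ℝ → ℝ} {a b c d e f : ℝ}
    (h : AlphaLim O Sp Sm n1 n2 n3 a b c d e f) :
    AlphaLim O (fun t => -(1/2) * Sp t - Real.sqrt 3/2 * Sm t)
      (fun t => Real.sqrt 3/2 * Sp t - 1/2 * Sm t) n2 n3 n1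
      a (-(1/2) * b - Real.sqrt 3/2 * c) (Real.sqrt 3/2 * b - 1/2 * c) e f d := by
  obtain ⟨s, hs, h0, h1, h2, h3, h4, h5⟩ := h
  exact ⟨s, hs, h0, (h1.const_mul _).sub (h2.const_mul _), (h1.const_mul _).sub (h2.const_mul _),
    h4, h5, h3⟩

theorem AlphaLim.unrot {O Sp Sm n1 n2 n3 : ℝ → ℝ} {a b c d e f : ℝ}
    (h : AlphaLim O (fun t => -(1/2) * Sp t - Real.sqrt 3/2 * Sm t)
      (fun t => Real.sqrt 3/2 * Sp t - 1/2 * Sm t) n2 n3 n1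
      a (-(1/2) * b - Real.sqrt 3/2 * c) (Real.sqrt 3/2 * b - 1/2 * c) e f d) :
    AlphaLim O Sp Sm n1 n2 n3 a b c d e f := by
  have hh : Real.sqrt 3 ^2 = 3 := Real.sq_sqrt (by norm_num)
  obtain ⟨s, hs, h0, h1, h2, h3, h4, h5⟩ := h
  refine ⟨s, hs, h0, ?_, ?_, h5, h3, h4⟩
  · convert (h1.const_mul (-(1/2))).add (h2.const_mul (Real.sqrt 3/2)) using 2
    · linear_combination (-(1/4) * Sp (s _)) * hh
    · linear_combination (-(1/4) * b) * hh
  · convert (h1.const_mul (-(Real.sqrt 3/2))).sub (h2.const_mul (1/2)) using 2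
    · linear_combination (-(1/4) * Sm (s _)) * hh
    · linear_combination (-(1/4) * c) * hh

theorem OmegaLim.rot {O Sp Sm n1 n2 n3 : ℝ → ℝ} {a b c d e f : ℝ}
    (h : OmegaLim O Sp Sm n1 n2 n3 a b c d e f) :
    OmegaLim O (fun t => -(1/2) * Sp t - Real.sqrt 3/2 * Sm t)
      (fun t => Real.sqrt 3/2 * Sp t - 1/2 * Sm t) n2 n3 n1
      a (-(1/2) * b - Real.sqrt 3/2 * c) (Real.sqrt 3/2 * b - 1/2 * c) e f d := by
  obtain ⟨s, hs, h0, h1, h2, h3, h4, h5⟩ := h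
  exact ⟨s, hs, h0, (h1.const_mul _).sub (h2.const_mul _), (h1.const_mul _).sub (h2.const_mul _),
    h4, h5, h3⟩

theorem rot_circle {a b : ℝ} (hab : a^2 + b^2 = 1) :
    (-(1/2) * a - Real.sqrt 3/2 * b)^2 + (Real.sqrt 3/2 * a - 1/2 * b)^2 = 1 := by
  have h3 : Real.sqrt 3 ^2 = 3 := Real.sq_sqrt (by norm_num)
  linear_combination hab + (1/4) * (a^2+b^2) * h3

theorem case2 {γ : ℝ} (hγ1 : 2/3 < γ) (hγ2 : γ < 2)
    {O Sp Sm n1 n2 n3 : ℝ → ℝ}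
    (hsol : SolOn γ (Set.Iic 0) O Sp Sm n1 n2 n3)
    (hIX : ∀ τ ∈ Set.Iic (0:ℝ), 0 < n1 τ ∧ 0 < n2 τ ∧ 0 < n3 τ)
    {a b : ℝ} (hab : a^2 + b^2 = 1) (ha : a + Real.sqrt 3 * b < -1)
    (hlim : AlphaLim O Sp Sm n1 n2 n3 0 a b 0 0 0)
    {Oy Spy Smy m1 m2 m3 : ℝ → ℝ}
    (hy : SolOn γ Set.univ Oy Spy Smy m1 m2 m3)
    (hOy : ∀ t, Oy t = 0) (hm1 : ∀ t, m1 t = 0) (hm2 : ∀ t, 0 < m2 t) (hm3 : ∀ t, m3 t = 0)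
    (hom : OmegaLim Oy Spy Smy m1 m2 m3 0 a b 0 0 0) (t : ℝ) :
    AlphaLim O Sp Sm n1 n2 n3 (Oy t) (Spy t) (Smy t) (m1 t) (m2 t) (m3 t) :=
  AlphaLim.unrot (case1 hγ1 hγ2 hsol.rot (fun τ h => ⟨(hIX τ h).2.1, (hIX τ h).2.2, (hIX τ h).1⟩)
    (rot_circle hab) (by linarith) hlim.rot hy.rot hOy hm2 hm3 hm1 hom.rot t)

theorem case3 {γ : ℝ} (hγ1 : 2/3 < γ) (hγ2 : γ < 2)
    {O Sp Sm n1 n2 n3 : ℝ → ℝ}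
    (hsol : SolOn γ (Set.Iic 0) O Sp Sm n1 n2 n3)
    (hIX : ∀ τ ∈ Set.Iic (0:ℝ), 0 < n1 τ ∧ 0 < n2 τ ∧ 0 < n3 τ)
    {a b : ℝ} (hab : a^2 + b^2 = 1) (ha : a - Real.sqrt 3 * b < -1)
    (hlim : AlphaLim O Sp Sm n1 n2 n3 0 a b 0 0 0)
    {Oy Spy Smy m1 m2 m3 : ℝ → ℝ}
    (hy : SolOn γ Set.univ Oy Spy Smy m1 m2 m3)
    (hOy : ∀ t, Oy t = 0) (hm1 : ∀ t, m1 t = 0) (hm2 : ∀ t, m2 t = 0) (hm3 : ∀ t, 0 < m3 t)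
    (hom : OmegaLim Oy Spy Smy m1 m2 m3 0 a b 0 0 0) (t : ℝ) :
    AlphaLim O Sp Sm n1 n2 n3 (Oy t) (Spy t) (Smy t) (m1 t) (m2 t) (m3 t) :=
  AlphaLim.unrot (case2 hγ1 hγ2 hsol.rot (fun τ h => ⟨(hIX τ h).2.1, (hIX τ h).2.2, (hIX τ h).1⟩)
    (rot_circle hab) (by
      have h3 : Real.sqrt 3 ^2 = 3 := Real.sq_sqrt (by norm_num)
      have h4 : -(1/2) * a - Real.sqrt 3/2 * b + Real.sqrt 3 * (Real.sqrt 3/2 * a - 1/2 * b)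
          = a - Real.sqrt 3 * b := by linear_combination (1/2) * a * h3
      rw [h4]; exact ha) hlim.rot hy.rot hOy hm2 hm3 hm1 hom.rot t)

theorem closure_aux {O Sp Sm n1 n2 n3 Oy Spy Smy m1 m2 m3 : ℝ → ℝ}
    (h : ∀ t, AlphaLim O Sp Sm n1 n2 n3 (Oy t) (Spy t) (Smy t) (m1 t) (m2 t) (m3 t)) :
    ∀ p ∈ closure (Set.range (fun t =>
        (![Oy t, Spy t, Smy t, m1 t, m2 t, m3 t] : Fin 6 → ℝ))),
        AlphaLimPt O Sp Sm n1 n2 n3 p := by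
  intro p hp
  have key : ∀ n : ℕ, ∃ τ : ℝ, τ ≤ -(n:ℝ) ∧
      dist (![O τ, Sp τ, Sm τ, n1 τ, n2 τ, n3 τ] : Fin 6 → ℝ) p ≤ 1/((n:ℝ)+1) := by
    intro n
    have hpos : 0 < 1/((n:ℝ)+1)/2 := by positivity
    obtain ⟨_, ⟨t, rfl⟩, ht⟩ := Metric.mem_closure_iff.1 hp _ hpos
    obtain ⟨s, hs, h0, h1, h2, h3, h4, h5⟩ := h t
    have hv : Tendsto (fun k => (![O (s k), Sp (s k), Sm (s k), n1 (s k), n2 (s k), n3 (s k)] :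
        Fin 6 → ℝ)) atTop (𝓝 ![Oy t, Spy t, Smy t, m1 t, m2 t, m3 t]) := by
      rw [tendsto_pi_nhds]
      intro i
      fin_cases i
      · exact h0
      · exact h1
      · exact h2
      · exact h3
      · exact h4
      · exact h5
    obtain ⟨k, hk1, hk2⟩ := ((hs.eventually_le_atBot (-(n:ℝ))).and
      (hv.eventually (Metric.ball_mem_nhds _ hpos))).exists
    refine ⟨s k, hk1, ?_⟩
    have hk3 : dist _ _ < _ := hk2
    have := dist_triangle (![O (s k), Sp (s k), Sm (s k), n1 (s k), n2 (s k), n3 (s k)] :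
        Fin 6 → ℝ) ![Oy t, Spy t, Smy t, m1 t, m2 t, m3 t] p
    rw [dist_comm p] at ht
    linarith
  choose τs h1 h2 using key
  refine ⟨τs, tendsto_atBot_mono h1 (tendsto_neg_atTop_atBot.comp tendsto_natCast_atTop_atTop), ?_⟩
  rw [tendsto_iff_dist_tendsto_zero]
  exact squeeze_zero (fun _ => dist_nonneg) h2 tendsto_one_div_add_atTop_nhds_zero_nat

theorem arcs {a b : ℝ} (hns : NonSpecialKasner a b) :
    ((1/2 < a ∧ ¬ (a + Real.sqrt 3 * b < -1) ∧ ¬ (a - Real.sqrt 3 * b < -1)) ∨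
     (¬ (1/2 < a) ∧ a + Real.sqrt 3 * b < -1 ∧ ¬ (a - Real.sqrt 3 * b < -1)) ∨
     (¬ (1/2 < a) ∧ ¬ (a + Real.sqrt 3 * b < -1) ∧ a - Real.sqrt 3 * b < -1)) := by
  obtain ⟨hab, s1, s2, s3⟩ := hns
  have h3 : Real.sqrt 3 ^2 = 3 := Real.sq_sqrt (by norm_num)
  have ham : -1 ≤ a := by nlinarith [sq_nonneg b]
  by_cases ha : 1/2 < a
  · obtain ⟨p1, p2⟩ := arc_ineq hab ha
    exact Or.inl ⟨ha, by linarith, by linarith⟩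
  · by_cases h1 : a + Real.sqrt 3 * b < -1
    · exact Or.inr (Or.inl ⟨ha, h1, by linarith⟩)
    · by_cases h2 : a - Real.sqrt 3 * b < -1
      · exact Or.inr (Or.inr ⟨ha, h1, h2⟩)
      · exfalso
        push Not at ha h1 h2
        have h4 : (Real.sqrt 3 * b)^2 ≤ (1+a)^2 := sq_le_sq' (by linarith) (by linarith)
        rw [mul_pow, h3] at h4
        have h5 : (1+a) * (1 - 2*a) ≤ 0 := by nlinarith
        rcases eq_or_lt_of_le ham with h | h
        · apply s1
          have : b = 0 := by
            have : b^2 = 0 := by rw [← h] at hab; linarith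
            simpa using this
          rw [← h, this]
        · have ha2 : a = 1/2 := by
            have : 1 - 2*a ≤ 0 := by
              by_contra hh
              push Not at hh
              nlinarith
            linarith
          have hb : (b - Real.sqrt 3/2) * (b + Real.sqrt 3/2) = 0 := by
            rw [ha2] at hab
            linear_combination hab - (1/4) * h3
          rcases mul_eq_zero.1 hb with hb | hb
          · apply s2; rw [ha2, sub_eq_zero.1 hb]
          · apply s3; rw [ha2, eq_neg_of_add_eq_zero_left hb, neg_div]

/-- if a Bianchi IX solution with `2/3 < γ < 2` has a non-special α-limit
point `p = (Σ₊, Σ₋) = (a, b)` on the Kasner circle, then `p` lies in exactly one of the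
arcs `K₁, K₂, K₃`, and for any vacuum type II solution (with the corresponding `Nᵢ > 0`)
having `p` as an ω-limit point, the closure of its image is contained in the α-limit set
of the given solution. -/
theorem kasner_map_orbit_in_alpha_limit_set
    (γ : ℝ) (hγ1 : 2/3 < γ) (hγ2 : γ < 2)
    (O Sp Sm n1 n2 n3 : ℝ → ℝ)
    (hsol : SolOn γ (Set.Iic 0) O Sp Sm n1 n2 n3)
    (hIX : ∀ τ ∈ Set.Iic (0:ℝ), 0 < n1 τ ∧ 0 < n2 τ ∧ 0 < n3 τ)
    (a b : ℝ) (hns : NonSpecialKasner a b)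
    (hlim : AlphaLim O Sp Sm n1 n2 n3 0 a b 0 0 0) :
    ((1/2 < a ∧ ¬ (a + Real.sqrt 3 * b < -1) ∧ ¬ (a - Real.sqrt 3 * b < -1)) ∨
     (¬ (1/2 < a) ∧ a + Real.sqrt 3 * b < -1 ∧ ¬ (a - Real.sqrt 3 * b < -1)) ∨
     (¬ (1/2 < a) ∧ ¬ (a + Real.sqrt 3 * b < -1) ∧ a - Real.sqrt 3 * b < -1)) ∧
    (1/2 < a → ∀ Oy Spy Smy m1 m2 m3 : ℝ → ℝ,
      SolOn γ Set.univ Oy Spy Smy m1 m2 m3 →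
      (∀ t, Oy t = 0) → (∀ t, 0 < m1 t) → (∀ t, m2 t = 0) → (∀ t, m3 t = 0) →
      OmegaLim Oy Spy Smy m1 m2 m3 0 a b 0 0 0 →
      ∀ p ∈ closure (Set.range (fun t =>
        (![Oy t, Spy t, Smy t, m1 t, m2 t, m3 t] : Fin 6 → ℝ))),
        AlphaLimPt O Sp Sm n1 n2 n3 p) ∧
    (a + Real.sqrt 3 * b < -1 → ∀ Oy Spy Smy m1 m2 m3 : ℝ → ℝ,
      SolOn γ Set.univ Oy Spy Smy m1 m2 m3 →
      (∀ t, Oy t = 0) → (∀ t, m1 t = 0) → (∀ t, 0 < m2 t) → (∀ t, m3 t = 0) →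
      OmegaLim Oy Spy Smy m1 m2 m3 0 a b 0 0 0 →
      ∀ p ∈ closure (Set.range (fun t =>
        (![Oy t, Spy t, Smy t, m1 t, m2 t, m3 t] : Fin 6 → ℝ))),
        AlphaLimPt O Sp Sm n1 n2 n3 p) ∧
    (a - Real.sqrt 3 * b < -1 → ∀ Oy Spy Smy m1 m2 m3 : ℝ → ℝ,
      SolOn γ Set.univ Oy Spy Smy m1 m2 m3 →
      (∀ t, Oy t = 0) → (∀ t, m1 t = 0) → (∀ t, m2 t = 0) → (∀ t, 0 < m3 t) →
      OmegaLim Oy Spy Smy m1 m2 m3 0 a b 0 0 0 →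
      ∀ p ∈ closure (Set.range (fun t =>
        (![Oy t, Spy t, Smy t, m1 t, m2 t, m3 t] : Fin 6 → ℝ))),
        AlphaLimPt O Sp Sm n1 n2 n3 p) := by
  refine ⟨arcs hns, ?_, ?_, ?_⟩
  · intro ha Oy Spy Smy m1 m2 m3 hy hO h1 h2 h3 hom
    exact closure_aux (case1 hγ1 hγ2 hsol hIX hns.1 ha hlim hy hO h1 h2 h3 hom)
  · intro ha Oy Spy Smy m1 m2 m3 hy hO h1 h2 h3 hom
    exact closure_aux (case2 hγ1 hγ2 hsol hIX hns.1 ha hlim hy hO h1 h2 h3 hom)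
  · intro ha Oy Spy Smy m1 m2 m3 hy hO h1 h2 h3 hom
    exact closure_aux (case3 hγ1 hγ2 hsol hIX hns.1 ha hlim hy hO h1 h2 h3 hom)

end WainwrightHsu
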